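/- arXiv:0906.0199 — 2 statements merged into one kernel-verified Lean document; each statement's English description precedes it below -/
import Mathlib

section
/- Every five-point locally two-distance set in the plane ℝ² is a two-distance set, and is similar to the vertex set of a regular pentagon. -/
open scoped Classical

/-- `A_X(x)`: the set of distances from `x` to the other points of `X`. -/
noncomputable def distancesFrom (X : Finset (EuclideanSpace ℝ (Fin 2)))
    (x : EuclideanSpace ℝ (Fin 2)) : Finset ℝ :=
  (X.erase x).image (fun y => dist x y)

/-- `A(X)`: the set of distances between distinct points of `X`. -/
noncomputable def distSet (X : Finset (EuclideanSpace ℝ (Fin 2))) : Finset ℝ :=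
  X.offDiag.image (fun p => dist p.1 p.2)

/-- The vertex set of a regular pentagon inscribed in the unit circle. -/
noncomputable def regularPentagon : Finset (EuclideanSpace ℝ (Fin 2)) :=
  (Finset.range 5).image (fun j => (WithLp.equiv 2 (Fin 2 → ℝ)).symm
    ![Real.cos (2 * Real.pi * j / 5), Real.sin (2 * Real.pi * j / 5)])

/-- The Cayley–Menger polynomial of four points, in terms of the squared distances. -/
def cayleyMenger (a b c d e f : ℝ) : ℝ :=
  a * f * (-a + b + c + d + e - f) + b * e * (a - b + c + d - e + f)
    + c * d * (a + b - c - d + e + f) - a * b * d - a * c * e - b * c * f - d * e * f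

theorem dist_sq_eq_coord (x y : EuclideanSpace ℝ (Fin 2)) :
    dist x y ^ 2 = (x 0 - y 0) ^ 2 + (x 1 - y 1) ^ 2 := by
  rw [EuclideanSpace.dist_eq, Real.sq_sqrt (by positivity)]
  simp [Real.dist_eq, sq_abs]

theorem cayleyMenger_eq_zero (x y z w : EuclideanSpace ℝ (Fin 2)) :
    cayleyMenger (dist x y ^ 2) (dist x z ^ 2) (dist x w ^ 2) (dist y z ^ 2) (dist y w ^ 2)
      (dist z w ^ 2) = 0 := by
  simp only [dist_sq_eq_coord, cayleyMenger]
  ring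

/-- Six times the value of `A / B + B / A` when a four-point planar set whose squared distances
are `A` on the edges labelled `true` and `B` on the other edges exists. -/
def ratioInvariant (b₁₂ b₁₃ b₁₄ b₂₃ b₂₄ b₃₄ : Bool) : ℕ :=
  let n := b₁₂.toNat + b₁₃.toNat + b₁₄.toNat + b₂₃.toNat + b₂₄.toNat + b₃₄.toNat
  let opposite := b₁₂ == b₃₄ && b₁₃ == b₂₄ && b₁₄ == b₂₃
  let noOpposite := b₁₂ != b₃₄ && b₁₃ != b₂₄ && b₁₄ != b₂₃
  match n with
  | 1 | 5 => 20
  | 2 | 4 => if opposite then 15 else 24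
  | 3 => if noOpposite then 20 else 18
  | _ => 0

theorem sq_add_sq_eq_of_cayleyMenger {A B : ℝ} (hA : 0 < A) (hB : 0 < B)
    (b₁₂ b₁₃ b₁₄ b₂₃ b₂₄ b₃₄ : Bool)
    (h : cayleyMenger (if b₁₂ then A else B) (if b₁₃ then A else B) (if b₁₄ then A else B)
      (if b₂₃ then A else B) (if b₂₄ then A else B) (if b₃₄ then A else B) = 0) :
    6 * (A ^ 2 + B ^ 2) = ratioInvariant b₁₂ b₁₃ b₁₄ b₂₃ b₂₄ b₃₄ * (A * B) := by
  have hs : A + B ≠ 0 := by positivity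
  have hA := hA.ne'
  have hB := hB.ne'
  cases b₁₂ <;> cases b₁₃ <;> cases b₁₄ <;> cases b₂₃ <;> cases b₂₄ <;> cases b₃₄ <;>
    simp [cayleyMenger, ratioInvariant] at h ⊢ <;> grind

/-- If `z` is equidistant from `x₁`, `x₂` and from `y₁`, `y₂`, and each of `x₁`, `x₂` is
equidistant from `y₁`, `y₂`, then `z` is the midpoint of `x₁` and `x₂`. -/
theorem dist_sq_eq_four_mul {x₁ x₂ y₁ y₂ z : EuclideanSpace ℝ (Fin 2)}
    (hx : x₁ ≠ x₂) (hy : y₁ ≠ y₂) (h1 : dist x₁ y₂ = dist x₁ y₁) (h2 : dist x₂ y₂ = dist x₂ y₁)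
    (hxz : dist x₂ z = dist x₁ z) (hyz : dist y₂ z = dist y₁ z) :
    dist x₁ x₂ ^ 2 = 4 * dist x₁ z ^ 2 := by
  have hx' : dist x₁ x₂ ^ 2 ≠ 0 := pow_ne_zero _ (dist_ne_zero.2 hx)
  have hy' : dist y₁ y₂ ^ 2 ≠ 0 := pow_ne_zero _ (dist_ne_zero.2 hy)
  replace h1 := congrArg (· ^ 2) h1
  replace h2 := congrArg (· ^ 2) h2
  replace hxz := congrArg (· ^ 2) hxz
  replace hyz := congrArg (· ^ 2) hyz
  simp only [dist_sq_eq_coord] at *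
  generalize z 0 = z0 at *
  generalize z 1 = z1 at *
  obtain ⟨a, ha⟩ : ∃ a, a = x₁ 0 - z0 := ⟨_, rfl⟩
  obtain ⟨b, hb⟩ : ∃ a, a = x₁ 1 - z1 := ⟨_, rfl⟩
  obtain ⟨c, hc⟩ : ∃ a, a = x₂ 0 - z0 := ⟨_, rfl⟩
  obtain ⟨e, he⟩ : ∃ a, a = x₂ 1 - z1 := ⟨_, rfl⟩
  obtain ⟨f, hf⟩ : ∃ a, a = y₁ 0 - y₂ 0 := ⟨_, rfl⟩
  obtain ⟨g, hg⟩ : ∃ a, a = y₁ 1 - y₂ 1 := ⟨_, rfl⟩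
  have o1 : a * f + b * g = 0 := by subst_vars; linear_combination (h1 - hyz) / 2
  have o2 : c * f + e * g = 0 := by subst_vars; linear_combination (h2 - hyz) / 2
  rw [← hf, ← hg] at hy'
  have hdet : a * e - b * c = 0 := by
    have : (a * e - b * c) * (f ^ 2 + g ^ 2) = 0 := by
      linear_combination (e * f - c * g) * o1 + (a * g - b * f) * o2
    exact (mul_eq_zero.1 this).resolve_right hy'
  have hn : c ^ 2 + e ^ 2 = a ^ 2 + b ^ 2 := by subst_vars; exact hxz
  have e1 : (x₁ 0 - x₂ 0) = a - c := by subst_vars; ring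
  have e2 : (x₁ 1 - x₂ 1) = b - e := by subst_vars; ring
  rw [e1, e2] at hx' ⊢
  rw [← ha, ← hb]
  have : ((a - c) ^ 2 + (b - e) ^ 2) *
      ((a - c) ^ 2 + (b - e) ^ 2 - 4 * (a ^ 2 + b ^ 2)) = 0 := by
    linear_combination (-4) * (a * e - b * c) * hdet +
      (c ^ 2 + e ^ 2 + 3 * (a ^ 2 + b ^ 2) - 4 * (a * c + b * e)) * hn
  linarith [(mul_eq_zero.1 this).resolve_left hx']

theorem false_of_rhombus_of_equidistant {x₁ x₂ y₁ y₂ z : EuclideanSpace ℝ (Fin 2)}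
    (hx : x₁ ≠ x₂) (hy : y₁ ≠ y₂) (hz : x₁ ≠ z)
    (h12 : dist x₁ y₂ = dist x₁ y₁) (h21 : dist x₂ y₁ = dist x₁ y₁)
    (h22 : dist x₂ y₂ = dist x₁ y₁) (hxz : dist x₂ z = dist x₁ z) (hyz : dist y₂ z = dist y₁ z)
    (hxx : dist x₁ x₂ = dist x₁ z ∨ dist x₁ x₂ = dist x₁ y₁)
    (hyy : dist y₁ y₂ = dist y₁ z ∨ dist y₁ y₂ = dist x₁ y₁) : False := by
  have hx' := dist_sq_eq_four_mul hx hy h12 (h22.trans h21.symm) hxz hyz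
  have hy' := dist_sq_eq_four_mul hy hx (by rw [dist_comm, h21, dist_comm])
    (by rw [dist_comm, h22, dist_comm y₂, h12]) hyz hxz
  have hcm := cayleyMenger_eq_zero x₁ x₂ y₁ y₂
  have hxpos : 0 < dist x₁ z ^ 2 := pow_pos (dist_pos.2 hz) 2
  have hypos : 0 < dist y₁ y₂ ^ 2 := pow_pos (dist_pos.2 hy) 2
  rw [h12, h21, h22] at hcm
  rcases hxx with h | h
  · rw [h] at hx'; linarith
  rcases hyy with h' | h'
  · rw [h'] at hy' hypos; linarith
  rw [h, h'] at hcm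
  have : (dist x₁ y₁ ^ 2) ^ 3 = 0 := by
    unfold cayleyMenger at hcm
    linear_combination hcm / 2
  rw [← h'] at this
  exact (pow_pos hypos 3).ne' this

/-- The symmetric `5 × 5` table with the given entries above the diagonal. -/
def symmetricTable (b₀₁ b₀₂ b₀₃ b₀₄ b₁₂ b₁₃ b₁₄ b₂₃ b₂₄ b₃₄ : Bool) : Fin 5 → Fin 5 → Bool :=
  ![![false, b₀₁, b₀₂, b₀₃, b₀₄], ![b₀₁, false, b₁₂, b₁₃, b₁₄], ![b₀₂, b₁₂, false, b₂₃, b₂₄],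
    ![b₀₃, b₁₃, b₂₃, false, b₃₄], ![b₀₄, b₁₄, b₂₄, b₃₄, false]]

/-- Two vertices of a `2`-coloured complete graph each see the other three in a single colour. -/
abbrev HasTwoCenters (b : Fin 5 → Fin 5 → Bool) : Prop :=
  ∃ u v, u < v ∧ ∃ x, x ≠ u ∧ x ≠ v ∧ ∃ y, x < y ∧ y ≠ u ∧ y ≠ v ∧
    ∃ z, y < z ∧ z ≠ u ∧ z ≠ v ∧ b u x = b u y ∧ b u x = b u z ∧ b v x = b v y ∧ b v x = b v z

/-- The edges labelled `true` form a `5`-cycle. -/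
abbrev IsFiveCycle (b : Fin 5 → Fin 5 → Bool) : Prop :=
  ∃ i, i ≠ 0 ∧ b 0 i = true ∧ ∃ j, j ≠ 0 ∧ j ≠ i ∧ b i j = true ∧ b 0 j = false ∧
    ∃ k, k ≠ 0 ∧ k ≠ i ∧ k ≠ j ∧ b j k = true ∧ b 0 k = false ∧ b i k = false ∧
    ∃ l, l ≠ 0 ∧ l ≠ i ∧ l ≠ j ∧ l ≠ k ∧ b k l = true ∧ b 0 l = true ∧ b i l = false ∧
      b j l = false

theorem isFiveCycle_of_ratioInvariant_eq : ∀ b₀₁ b₀₂ b₀₃ b₀₄ b₁₂ b₁₃ b₁₄ b₂₃ b₂₄ b₃₄ : Bool,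
    ratioInvariant b₀₁ b₀₂ b₀₃ b₁₂ b₁₃ b₂₃ = ratioInvariant b₀₁ b₀₂ b₀₄ b₁₂ b₁₄ b₂₄ →
    ratioInvariant b₀₁ b₀₂ b₀₃ b₁₂ b₁₃ b₂₃ = ratioInvariant b₀₁ b₀₃ b₀₄ b₁₃ b₁₄ b₃₄ →
    ratioInvariant b₀₁ b₀₂ b₀₃ b₁₂ b₁₃ b₂₃ = ratioInvariant b₀₂ b₀₃ b₀₄ b₂₃ b₂₄ b₃₄ →
    ratioInvariant b₀₁ b₀₂ b₀₃ b₁₂ b₁₃ b₂₃ = ratioInvariant b₁₂ b₁₃ b₁₄ b₂₃ b₂₄ b₃₄ →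
    HasTwoCenters (symmetricTable b₀₁ b₀₂ b₀₃ b₀₄ b₁₂ b₁₃ b₁₄ b₂₃ b₂₄ b₃₄) ∨
    (ratioInvariant b₀₁ b₀₂ b₀₃ b₁₂ b₁₃ b₂₃ = 18 ∧
      IsFiveCycle (symmetricTable b₀₁ b₀₂ b₀₃ b₀₄ b₁₂ b₁₃ b₁₄ b₂₃ b₂₄ b₃₄)) := by
  decide +kernel

theorem exists_similarity_of_dist_eq {ι V : Type*} [Fintype ι] [Nonempty ι]
    [NormedAddCommGroup V] [InnerProductSpace ℝ V] [FiniteDimensional ℝ V]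
    {p q : ι → V} {r : ℝ} (hr : 0 < r) (h : ∀ i j, dist (p i) (p j) = r * dist (q i) (q j)) :
    ∃ f : V → V, (∀ x y, dist (f x) (f y) = r * dist x y) ∧ ∀ i, f (q i) = p i := by
  classical
  let o : ι := Classical.arbitrary ι
  let T : (ι → ℝ) →ₗ[ℝ] V := Fintype.linearCombination ℝ (fun i => q i - q o)
  let U : (ι → ℝ) →ₗ[ℝ] V := r⁻¹ • Fintype.linearCombination ℝ (fun i => p i - p o)
  have hinner : ∀ i j, inner ℝ (p i - p o) (p j - p o) =
      r ^ 2 * inner ℝ (q i - q o) (q j - q o) := by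
    intro i j
    rw [real_inner_eq_norm_mul_self_add_norm_mul_self_sub_norm_sub_mul_self_div_two,
      real_inner_eq_norm_mul_self_add_norm_mul_self_sub_norm_sub_mul_self_div_two]
    simp only [sub_sub_sub_cancel_right, ← dist_eq_norm, h]
    ring
  have hnorm : ∀ x, ‖U x‖ = ‖T x‖ := by
    intro x
    rw [← sq_eq_sq₀ (norm_nonneg _) (norm_nonneg _), ← real_inner_self_eq_norm_sq,
      ← real_inner_self_eq_norm_sq]
    simp only [U, T, LinearMap.smul_apply, Fintype.linearCombination_apply, inner_smul_left,
      inner_smul_right, sum_inner, inner_sum, hinner, Finset.mul_sum]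
    refine Finset.sum_congr rfl fun i _ => Finset.sum_congr rfl fun j _ => ?_
    simp
    field_simp
  obtain ⟨s, hs⟩ := T.rangeRestrict.exists_rightInverse_of_surjective T.range_rangeRestrict
  have hTs : ∀ y : LinearMap.range T, T (s y) = y := fun y =>
    congrArg Subtype.val (LinearMap.congr_fun hs y)
  let L : LinearMap.range T →ₗᵢ[ℝ] V :=
    { toLinearMap := U ∘ₗ s
      norm_map' := fun y => by simp [hnorm, hTs] }
  have hL : ∀ x, L.extend (T x) = U x := by
    intro x
    have : L.extend (T x) = U (s ⟨T x, x, rfl⟩) := L.extend_apply ⟨T x, x, rfl⟩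
    rw [this, ← sub_eq_zero, ← map_sub, ← norm_eq_zero, hnorm, map_sub, hTs, sub_self, norm_zero]
  refine ⟨fun x => p o + r • L.extend (x - q o), fun x y => ?_, fun i => ?_⟩
  · rw [dist_add_left, dist_smul₀, LinearIsometry.dist_map, dist_sub_right,
      Real.norm_of_nonneg hr.le]
  · have := hL (Pi.single i 1)
    simp only [T, U, LinearMap.smul_apply, Fintype.linearCombination_apply_single, one_smul] at this
    simp [this, ne_of_gt hr]

/-- The `j`-th vertex of the regular pentagon inscribed in the unit circle. -/
noncomputable def pentagonVertex (j : ℕ) : EuclideanSpace ℝ (Fin 2) :=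
  (WithLp.equiv 2 (Fin 2 → ℝ)).symm
    ![Real.cos (2 * Real.pi * j / 5), Real.sin (2 * Real.pi * j / 5)]

theorem mem_regularPentagon {x : EuclideanSpace ℝ (Fin 2)} :
    x ∈ regularPentagon ↔ ∃ j : Fin 5, pentagonVertex j = x := by
  simp only [regularPentagon, Finset.mem_image, Finset.bind_def, Finset.pure_def, Finset.mem_sup,
    Finset.mem_range, Finset.mem_singleton]
  constructor
  · rintro ⟨_, ⟨j, hj, rfl⟩, rfl⟩
    exact ⟨⟨j, hj⟩, rfl⟩
  · rintro ⟨j, rfl⟩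
    exact ⟨_, ⟨j, j.isLt, rfl⟩, rfl⟩

theorem dist_sq_pentagonVertex (i j : ℕ) :
    dist (pentagonVertex i) (pentagonVertex j) ^ 2 =
      2 - 2 * Real.cos (2 * Real.pi * (j - i) / 5) := by
  rw [dist_sq_eq_coord, show 2 * Real.pi * ((j : ℝ) - i) / 5 =
    2 * Real.pi * j / 5 - 2 * Real.pi * i / 5 by ring, Real.cos_sub]
  simp only [pentagonVertex, WithLp.equiv_symm_apply, Matrix.cons_val_zero, Matrix.cons_val_one]
  linear_combination Real.sin_sq_add_cos_sq (2 * Real.pi * j / 5) +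
    Real.sin_sq_add_cos_sq (2 * Real.pi * i / 5)

theorem cos_two_pi_div_five : Real.cos (2 * Real.pi / 5) = (√5 - 1) / 4 := by
  rw [show 2 * Real.pi / 5 = 2 * (Real.pi / 5) by ring, Real.cos_two_mul, Real.cos_pi_div_five]
  linear_combination Real.sq_sqrt (show (0 : ℝ) ≤ 5 by norm_num) / 8

theorem cos_four_pi_div_five : Real.cos (4 * Real.pi / 5) = -(1 + √5) / 4 := by
  rw [show 4 * Real.pi / 5 = Real.pi - Real.pi / 5 by ring, Real.cos_pi_sub, Real.cos_pi_div_five]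
  ring

theorem dist_sq_pentagonVertex_of_add_one {i j : ℕ} (h : j = i + 1 ∨ j = i + 4) :
    dist (pentagonVertex i) (pentagonVertex j) ^ 2 = (5 - √5) / 2 := by
  have : Real.cos (2 * Real.pi * (j - i) / 5) = (√5 - 1) / 4 := by
    rw [← cos_two_pi_div_five]
    rcases h with rfl | rfl
    · congr 1; push_cast; ring
    · rw [← Real.cos_two_pi_sub (2 * Real.pi / 5)]; congr 1; push_cast; ring
  rw [dist_sq_pentagonVertex, this]
  ring

theorem dist_sq_pentagonVertex_of_add_two {i j : ℕ} (h : j = i + 2 ∨ j = i + 3) :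
    dist (pentagonVertex i) (pentagonVertex j) ^ 2 = (5 + √5) / 2 := by
  have : Real.cos (2 * Real.pi * (j - i) / 5) = -(1 + √5) / 4 := by
    rw [← cos_four_pi_div_five]
    rcases h with rfl | rfl
    · congr 1; push_cast; ring
    · rw [← Real.cos_two_pi_sub (4 * Real.pi / 5)]; congr 1; push_cast; ring
  rw [dist_sq_pentagonVertex, this]
  ring

theorem exists_ratio_to_pentagonVertex {P : Fin 5 → EuclideanSpace ℝ (Fin 2)} {s t : ℝ}
    (hs : 0 < s) (hst : s < t) (hrel : (s ^ 2) ^ 2 + (t ^ 2) ^ 2 = 3 * (s ^ 2 * t ^ 2))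
    (h01 : dist (P 0) (P 1) = s) (h12 : dist (P 1) (P 2) = s) (h23 : dist (P 2) (P 3) = s)
    (h34 : dist (P 3) (P 4) = s) (h04 : dist (P 0) (P 4) = s) (h02 : dist (P 0) (P 2) = t)
    (h13 : dist (P 1) (P 3) = t) (h24 : dist (P 2) (P 4) = t) (h03 : dist (P 0) (P 3) = t)
    (h14 : dist (P 1) (P 4) = t) :
    ∃ r, 0 < r ∧ ∀ i j : Fin 5,
      dist (P i) (P j) = r * dist (pentagonVertex i) (pentagonVertex j) := by
  have hw : √(5 : ℝ) ^ 2 = 5 := Real.sq_sqrt (by norm_num)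
  have hw1 : 1 < √(5 : ℝ) := by rw [Real.lt_sqrt] <;> norm_num
  have hw5 : √(5 : ℝ) < 5 := by rw [Real.sqrt_lt'] <;> norm_num
  have hc : (0 : ℝ) < (5 - √5) / 2 := by linarith
  have hAB : s ^ 2 < t ^ 2 := pow_lt_pow_left₀ hst hs.le two_ne_zero
  have hA : 0 < s ^ 2 := by positivity
  have hratio : t ^ 2 = (3 + √5) / 2 * s ^ 2 := by
    have hprod : (t ^ 2 - (3 + √5) / 2 * s ^ 2) * (t ^ 2 - (3 - √5) / 2 * s ^ 2) = 0 := by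
      linear_combination hrel - (s ^ 2) ^ 2 * hw / 4
    have hpos : 0 < t ^ 2 - (3 - √5) / 2 * s ^ 2 := by nlinarith
    linarith [(mul_eq_zero.1 hprod).resolve_right hpos.ne']
  have hr : 0 < s / √((5 - √5) / 2) := div_pos hs (Real.sqrt_pos.2 hc)
  have side : ∀ i j : ℕ, (j = i + 1 ∨ j = i + 4) →
      s = s / √((5 - √5) / 2) * dist (pentagonVertex i) (pentagonVertex j) := by
    intro i j h
    rw [← Real.sqrt_sq (dist_nonneg (x := pentagonVertex i) (y := pentagonVertex j)),
      dist_sq_pentagonVertex_of_add_one h, div_mul_cancel₀ _ (Real.sqrt_pos.2 hc).ne']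
  have diag : ∀ i j : ℕ, (j = i + 2 ∨ j = i + 3) →
      t = s / √((5 - √5) / 2) * dist (pentagonVertex i) (pentagonVertex j) := by
    intro i j h
    rw [← sq_eq_sq₀ (hs.trans hst).le (by positivity), mul_pow, div_pow,
      dist_sq_pentagonVertex_of_add_two h, Real.sq_sqrt hc.le, hratio]
    rw [div_mul_eq_mul_div (s ^ 2), eq_div_iff hc.ne']
    linear_combination - (s ^ 2 / 4) * hw
  refine ⟨_, hr, ?_⟩
  have upper : ∀ i j : Fin 5, i < j → dist (P i) (P j) =
      s / √((5 - √5) / 2) * dist (pentagonVertex i) (pentagonVertex j) := by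
    intro i j hij
    fin_cases i <;> fin_cases j <;> first
      | exact absurd hij (by decide)
      | exact h01.trans (side _ _ (by decide))
      | exact h12.trans (side _ _ (by decide))
      | exact h23.trans (side _ _ (by decide))
      | exact h34.trans (side _ _ (by decide))
      | exact h04.trans (side _ _ (by decide))
      | exact h02.trans (diag _ _ (by decide))
      | exact h13.trans (diag _ _ (by decide))
      | exact h24.trans (diag _ _ (by decide))
      | exact h03.trans (diag _ _ (by decide))
      | exact h14.trans (diag _ _ (by decide))
  intro i j
  rcases lt_trichotomy i j with h | rfl | h
  · exact upper i j h
  · simp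
  · rw [dist_comm, upper j i h, dist_comm (pentagonVertex j)]

theorem eq_of_equidistant {u v x y z : EuclideanSpace ℝ (Fin 2)} (huv : u ≠ v) (hxy : x ≠ y)
    (hxz : x ≠ z) (hyz : y ≠ z) (h₁ : dist u x = dist u y) (h₂ : dist u x = dist u z)
    (h₃ : dist v x = dist v y) (h₄ : dist v x = dist v z) : False := by
  have := EuclideanGeometry.eq_of_dist_eq_of_dist_eq_of_finrank_eq_two
    (finrank_euclideanSpace_fin (𝕜 := ℝ) (n := 2)) huv hxy (p := z) (dist_comm x u)
    (by rw [dist_comm, h₁]) (by rw [dist_comm, h₂]) (dist_comm x v) (by rw [dist_comm, h₃])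
    (by rw [dist_comm, h₄])
  rcases this with h | h
  · exact hxz h.symm
  · exact hyz h.symm

theorem exists_pentagon_of_two_valued {p : Fin 5 → EuclideanSpace ℝ (Fin 2)} (hp : p.Injective)
    {s t : ℝ} (hs : 0 < s) (ht : 0 < t)
    (h : ∀ i j, i ≠ j → dist (p i) (p j) = s ∨ dist (p i) (p j) = t) :
    s ≠ t ∧ (∃ i j, i ≠ j ∧ dist (p i) (p j) = s) ∧ (∃ i j, i ≠ j ∧ dist (p i) (p j) = t) ∧
      ∃ σ : Fin 5 → Fin 5, σ.Injective ∧ ∃ r, 0 < r ∧ ∀ i j : Fin 5,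
        dist (p (σ i)) (p (σ j)) = r * dist (pentagonVertex i) (pentagonVertex j) := by
  obtain ⟨b, hb⟩ : ∃ b : Fin 5 → Fin 5 → Bool, ∀ i j, b i j = decide (dist (p i) (p j) = s) :=
    ⟨_, fun _ _ => rfl⟩
  have hdist : ∀ i j, i ≠ j → dist (p i) (p j) = if b i j then s else t := by
    intro i j hij
    by_cases hij' : dist (p i) (p j) = s
    · simp [hb, hij']
    · simpa [hb, hij'] using h i j hij
  have hbsymm : ∀ i j, b i j = b j i := fun i j => by simp only [hb, dist_comm]
  have htable : ∀ i j, i ≠ j → symmetricTable (b 0 1) (b 0 2) (b 0 3) (b 0 4) (b 1 2) (b 1 3)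
      (b 1 4) (b 2 3) (b 2 4) (b 3 4) i j = b i j := by
    intro i j hij
    fin_cases i <;> fin_cases j <;> first
      | exact absurd rfl hij
      | rfl
      | exact hbsymm _ _
  have hrel : ∀ i j k l : Fin 5, i < j → j < k → k < l →
      6 * ((s ^ 2) ^ 2 + (t ^ 2) ^ 2) =
        ratioInvariant (b i j) (b i k) (b i l) (b j k) (b j l) (b k l) * (s ^ 2 * t ^ 2) := by
    intro i j k l hij hjk hkl
    have hcm := cayleyMenger_eq_zero (p i) (p j) (p k) (p l)
    rw [hdist i j hij.ne, hdist i k (hij.trans hjk).ne, hdist i l (hij.trans (hjk.trans hkl)).ne,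
      hdist j k hjk.ne, hdist j l (hjk.trans hkl).ne, hdist k l hkl.ne] at hcm
    simp only [ite_pow] at hcm
    exact sq_add_sq_eq_of_cayleyMenger (by positivity) (by positivity) _ _ _ _ _ _ hcm
  have hinv : ∀ m n : ℕ, 6 * ((s ^ 2) ^ 2 + (t ^ 2) ^ 2) = m * (s ^ 2 * t ^ 2) →
      6 * ((s ^ 2) ^ 2 + (t ^ 2) ^ 2) = n * (s ^ 2 * t ^ 2) → m = n := by
    intro m n hm hn
    have hpos : s ^ 2 * t ^ 2 ≠ 0 := by positivity
    exact_mod_cast mul_right_cancel₀ hpos (hm.symm.trans hn)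
  have h0 := hrel 0 1 2 3 (by decide) (by decide) (by decide)
  rcases isFiveCycle_of_ratioInvariant_eq _ _ _ _ _ _ _ _ _ _
    (hinv _ _ h0 (hrel 0 1 2 4 (by decide) (by decide) (by decide)))
    (hinv _ _ h0 (hrel 0 1 3 4 (by decide) (by decide) (by decide)))
    (hinv _ _ h0 (hrel 0 2 3 4 (by decide) (by decide) (by decide)))
    (hinv _ _ h0 (hrel 1 2 3 4 (by decide) (by decide) (by decide))) with
    ⟨u, v, huv, x, hxu, hxv, y, hxy, hyu, hyv, z, hyz, hzu, hzv, h₁, h₂, h₃, h₄⟩ |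
    ⟨h18, i, hi0, h0i, j, hj0, hji, hij, h0j, k, hk0, hki, hkj, hjk, h0k, hik, l, hl0, hli, hlj,
      hlk, hkl, h0l, hil, hjl⟩
  · exfalso
    rw [htable u x hxu.symm] at h₁ h₂
    rw [htable u y hyu.symm] at h₁
    rw [htable u z hzu.symm] at h₂
    rw [htable v x hxv.symm] at h₃ h₄
    rw [htable v y hyv.symm] at h₃
    rw [htable v z hzv.symm] at h₄
    exact eq_of_equidistant (hp.ne huv.ne) (hp.ne hxy.ne) (hp.ne (hxy.trans hyz).ne)
      (hp.ne hyz.ne) (by rw [hdist u x hxu.symm, hdist u y hyu.symm, h₁])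
      (by rw [hdist u x hxu.symm, hdist u z hzu.symm, h₂])
      (by rw [hdist v x hxv.symm, hdist v y hyv.symm, h₃])
      (by rw [hdist v x hxv.symm, hdist v z hzv.symm, h₄])
  · have dist_of : ∀ {m n : Fin 5} {β : Bool}, n ≠ m → symmetricTable (b 0 1) (b 0 2) (b 0 3)
        (b 0 4) (b 1 2) (b 1 3) (b 1 4) (b 2 3) (b 2 4) (b 3 4) m n = β →
        dist (p m) (p n) = if β then s else t := by
      intro m n β hmn hβ
      rw [hdist m n hmn.symm, ← htable m n hmn.symm, hβ]
    have d0i := dist_of hi0 h0i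
    have dij := dist_of hji hij
    have djk := dist_of hkj hjk
    have dkl := dist_of hlk hkl
    have d0l := dist_of hl0 h0l
    have d0j := dist_of hj0 h0j
    have d0k := dist_of hk0 h0k
    have dik := dist_of hki hik
    have dil := dist_of hli hil
    have djl := dist_of hlj hjl
    simp only [if_true, Bool.false_eq_true, if_false] at d0i dij djk dkl d0l d0j d0k dik dil djl
    rw [h18] at h0
    have hrel' : (s ^ 2) ^ 2 + (t ^ 2) ^ 2 = 3 * (s ^ 2 * t ^ 2) := by
      push_cast at h0
      linarith
    have hst : s ≠ t := by
      rintro rfl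
      have : 0 < s ^ 2 * s ^ 2 := by positivity
      linarith
    refine ⟨hst, ⟨0, i, hi0.symm, d0i⟩, ⟨0, j, hj0.symm, d0j⟩, ?_⟩
    rcases hst.lt_or_gt with hlt | hlt
    · refine ⟨![0, i, j, k, l], ?_,
        exists_ratio_to_pentagonVertex (P := fun m => p (![0, i, j, k, l] m)) hs hlt hrel' d0i dij
          djk dkl d0l d0j dik djl d0k dil⟩
      clear * - hi0 hj0 hji hk0 hki hkj hl0 hli hlj hlk
      unfold Function.Injective
      revert i j k l
      decide
    · refine ⟨![0, j, l, i, k], ?_,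
        exists_ratio_to_pentagonVertex (P := fun m => p (![0, j, l, i, k] m)) ht hlt
          (by linarith) d0j djl (by simpa [dist_comm] using dil) dik d0k d0l
          (by simpa [dist_comm] using dij) (by simpa [dist_comm] using dkl) d0i djk⟩
      clear * - hi0 hj0 hji hk0 hki hkj hl0 hli hlj hlk
      unfold Function.Injective
      revert i j k l
      decide

theorem two_valued_of_common_value {d : Fin 5 → Fin 5 → ℝ} (hsymm : ∀ i j, d i j = d j i)
    {c : ℝ} {o : Fin 5 → ℝ} (hd : ∀ i j, i ≠ j → d i j = c ∨ d i j = o i)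
    (hcenter : ∀ u v x y z, u ≠ v → x ≠ y → x ≠ z → y ≠ z →
      d u x = d u y → d u x = d u z → d v x = d v y → d v x = d v z → False) :
    ∃ s t, ∀ i j, i ≠ j → d i j = s ∨ d i j = t := by
  by_cases h : ∃ i j, i ≠ j ∧ d i j ≠ c
  swap
  · push Not at h
    exact ⟨c, c, fun i j hij => Or.inl (h i j hij)⟩
  obtain ⟨i, j, hij, hdij⟩ := h
  refine ⟨c, d i j, fun k l hkl => ?_⟩
  by_contra! hne
  have oi : o i = d i j := ((hd i j hij).resolve_left hdij).symm
  have oj : o j = d i j := by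
    rw [hsymm] at hdij ⊢; exact ((hd j i hij.symm).resolve_left hdij).symm
  have ok : o k = d k l := ((hd k l hkl).resolve_left hne.1).symm
  have ol : o l = d k l := by
    rw [hsymm] at hne ⊢; exact ((hd l k hkl.symm).resolve_left hne.1).symm
  have eq_c : ∀ m n, m ≠ n → o m ≠ o n → d m n = c := fun m n hmn ho => by
    rcases hd m n hmn with h | h
    · exact h
    · rcases hd n m hmn.symm with h' | h'
      · rw [hsymm, h']
      · exact absurd (by rw [← h, ← h', hsymm]) ho
  have hik : i ≠ k := by rintro rfl; exact hne.2 (ok ▸ oi)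
  have hil : i ≠ l := by rintro rfl; exact hne.2 (ol ▸ oi)
  have hjk : j ≠ k := by rintro rfl; exact hne.2 (ok ▸ oj)
  have hjl : j ≠ l := by rintro rfl; exact hne.2 (ol ▸ oj)
  obtain ⟨m, hmi, hmj, hmk, hml⟩ : ∃ m, m ≠ i ∧ m ≠ j ∧ m ≠ k ∧ m ≠ l := by
    clear * -
    revert i j k l
    decide
  have hik' : d i k = c := eq_c _ _ hik (by rw [oi, ok]; exact hne.2.symm)
  have hil' : d i l = c := eq_c _ _ hil (by rw [oi, ol]; exact hne.2.symm)
  have hjk' : d j k = c := eq_c _ _ hjk (by rw [oj, ok]; exact hne.2.symm)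
  have hjl' : d j l = c := eq_c _ _ hjl (by rw [oj, ol]; exact hne.2.symm)
  by_cases hm : o m = d i j
  · have hkm : d k m = c := eq_c _ _ hmk.symm (by rw [hm, ok]; exact hne.2)
    have hlm : d l m = c := eq_c _ _ hml.symm (by rw [hm, ol]; exact hne.2)
    rw [hsymm] at hik' hil' hjk' hjl'
    exact hcenter k l i j m hkl hij hmi.symm hmj.symm (by rw [hik', hjk']) (by rw [hik', hkm])
      (by rw [hil', hjl']) (by rw [hil', hlm])
  · have him : d i m = c := eq_c _ _ hmi.symm (by rw [oi]; exact Ne.symm hm)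
    have hjm : d j m = c := eq_c _ _ hmj.symm (by rw [oj]; exact Ne.symm hm)
    exact hcenter i j k l m hij hkl hmk.symm hml.symm (by rw [hik', hil']) (by rw [hik', him])
      (by rw [hjk', hjl']) (by rw [hjk', hjm])

theorem exists_common_value {d : Fin 5 → Fin 5 → ℝ} (hsymm : ∀ i j, d i j = d j i)
    {a b : Fin 5 → ℝ} (hd : ∀ i j, i ≠ j → d i j = a i ∨ d i j = b i)
    (hcenter : ∀ u v x y z, u ≠ v → x ≠ y → x ≠ z → y ≠ z →
      d u x = d u y → d u x = d u z → d v x = d v y → d v x = d v z → False)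
    (hrhombus : ∀ x₁ x₂ y₁ y₂ z, x₁ ≠ x₂ → y₁ ≠ y₂ → x₁ ≠ z →
      d x₁ y₂ = d x₁ y₁ → d x₂ y₁ = d x₁ y₁ → d x₂ y₂ = d x₁ y₁ → d x₂ z = d x₁ z →
      d y₂ z = d y₁ z → (d x₁ x₂ = d x₁ z ∨ d x₁ x₂ = d x₁ y₁) →
      (d y₁ y₂ = d y₁ z ∨ d y₁ y₂ = d x₁ y₁) → False) :
    ∃ c, ∀ i, c = a i ∨ c = b i := by
  by_contra! hc
  obtain ⟨j, hja, hjb⟩ := hc (a 0)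
  obtain ⟨k, hka, hkb⟩ := hc (b 0)
  have h0j : (0 : Fin 5) ≠ j := by rintro rfl; exact hja rfl
  have h0k : (0 : Fin 5) ≠ k := by rintro rfl; exact hkb rfl
  have h1 := hd 0 j h0j
  have h2 := hd j 0 h0j.symm
  have h3 := hd 0 k h0k
  have h4 := hd k 0 h0k.symm
  rw [hsymm] at h2 h4
  have hdj : d 0 j = b 0 := by clear hcenter hrhombus hd hsymm; grind
  have hdk : d 0 k = a 0 := by clear hcenter hrhombus hd hsymm; grind
  have hjk : j ≠ k := by rintro rfl; clear hcenter hrhombus hd hsymm; grind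
  have h5 := hd j k hjk
  have h6 := hd k j hjk.symm
  rw [hsymm] at h6
  have hca : d j k ≠ a 0 := by clear hcenter hrhombus hd hsymm; grind
  have hcb : d j k ≠ b 0 := by clear hcenter hrhombus hd hsymm; grind
  have hab : a 0 ≠ b 0 := by clear hcenter hrhombus hd hsymm; grind
  obtain ⟨l, m, hl0, hlj, hlk, hm0, hmj, hmk, hlm⟩ :
      ∃ l m, l ≠ 0 ∧ l ≠ j ∧ l ≠ k ∧ m ≠ 0 ∧ m ≠ j ∧ m ≠ k ∧ l ≠ m := by
    clear * - h0j h0k hjk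
    revert j k
    decide
  have key : ∀ n, n ≠ 0 → n ≠ j → n ≠ k →
      (d n j = b 0 ∧ d n k = a 0 ∧ ∀ n', n ≠ n' → d n n' = a 0 ∨ d n n' = b 0) ∨
      (d n 0 = b 0 ∧ d n k = d j k ∧ ∀ n', n ≠ n' → d n n' = b 0 ∨ d n n' = d j k) ∨
      (d n 0 = a 0 ∧ d n j = d j k ∧ ∀ n', n ≠ n' → d n n' = a 0 ∨ d n n' = d j k) := by
    intro n hn0 hnj hnk
    have e1 := hd n 0 hn0
    have e2 := hd n j hnj
    have e3 := hd n k hnk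
    have e1' := hd 0 n hn0.symm
    have e2' := hd j n hnj.symm
    have e3' := hd k n hnk.symm
    rw [hsymm] at e1' e2' e3'
    have e4 := hd n
    clear hcenter hrhombus hd hsymm
    have e5 : (a n = a 0 ∧ b n = b 0) ∨ (a n = b 0 ∧ b n = a 0) ∨
      (a n = b 0 ∧ b n = d j k) ∨ (a n = d j k ∧ b n = b 0) ∨
      (a n = a 0 ∧ b n = d j k) ∨ (a n = d j k ∧ b n = a 0) := by grind
    rcases e5 with ⟨h, h'⟩ | ⟨h, h'⟩ | ⟨h, h'⟩ | ⟨h, h'⟩ | ⟨h, h'⟩ | ⟨h, h'⟩ <;>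
      rw [h, h'] at e1 e2 e3 <;> rw [h, h'] at e4 <;> grind
  have hl := key l hl0 hlj hlk
  have hm := key m hm0 hmj hmk
  have slm := hsymm l m
  have sl0 := hsymm l 0
  have slj := hsymm l j
  have slk := hsymm l k
  have sm0 := hsymm m 0
  have smj := hsymm m j
  have smk := hsymm m k
  have s0j := hsymm 0 j
  have s0k := hsymm 0 k
  have sjk := hsymm j k
  have c₁ := hcenter j k 0 l m
  have c₂ := hcenter 0 k j l m
  have c₃ := hcenter 0 j k l m
  have r₁ := hrhombus 0 l j m k
  have r₂ := hrhombus 0 m j l k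
  have r₃ := hrhombus 0 l k m j
  have r₄ := hrhombus 0 m k l j
  have r₅ := hrhombus j l k m 0
  have r₆ := hrhombus j m k l 0
  clear hcenter hrhombus key hc hsymm hd
  rcases hl with ⟨h₁, h₂, hl⟩ | ⟨h₁, h₂, hl⟩ | ⟨h₁, h₂, hl⟩ <;>
    rcases hm with ⟨h₃, h₄, hm⟩ | ⟨h₃, h₄, hm⟩ | ⟨h₃, h₄, hm⟩
  · clear c₂ c₃ r₁ r₂ r₃ r₄ r₅ r₆
    grind
  · clear c₁ c₂ c₃ r₂ r₃ r₄ r₅ r₆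
    grind
  · clear c₁ c₂ c₃ r₁ r₂ r₄ r₅ r₆
    grind
  · clear c₁ c₂ c₃ r₁ r₃ r₄ r₅ r₆
    grind
  · clear c₁ c₃ r₁ r₂ r₃ r₄ r₅ r₆
    grind
  · clear c₁ c₂ c₃ r₁ r₂ r₃ r₄ r₆
    grind
  · clear c₁ c₂ c₃ r₁ r₂ r₃ r₅ r₆
    grind
  · clear c₁ c₂ c₃ r₁ r₂ r₃ r₄ r₅
    grind
  · clear c₁ c₂ r₁ r₂ r₃ r₄ r₅ r₆
    grind

theorem two_valued_of_locally_two_valued {d : Fin 5 → Fin 5 → ℝ} (hsymm : ∀ i j, d i j = d j i)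
    {a b : Fin 5 → ℝ} (hd : ∀ i j, i ≠ j → d i j = a i ∨ d i j = b i)
    (hcenter : ∀ u v x y z, u ≠ v → x ≠ y → x ≠ z → y ≠ z →
      d u x = d u y → d u x = d u z → d v x = d v y → d v x = d v z → False)
    (hrhombus : ∀ x₁ x₂ y₁ y₂ z, x₁ ≠ x₂ → y₁ ≠ y₂ → x₁ ≠ z →
      d x₁ y₂ = d x₁ y₁ → d x₂ y₁ = d x₁ y₁ → d x₂ y₂ = d x₁ y₁ → d x₂ z = d x₁ z →
      d y₂ z = d y₁ z → (d x₁ x₂ = d x₁ z ∨ d x₁ x₂ = d x₁ y₁) →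
      (d y₁ y₂ = d y₁ z ∨ d y₁ y₂ = d x₁ y₁) → False) :
    ∃ s t, ∀ i j, i ≠ j → d i j = s ∨ d i j = t := by
  obtain ⟨c, hc⟩ := exists_common_value hsymm hd hcenter hrhombus
  refine two_valued_of_common_value hsymm (c := c) (o := fun i => if c = a i then b i else a i)
    (fun i j hij => ?_) hcenter
  rcases hd i j hij with h | h <;> rcases hc i with h' | h' <;> grind

/-- Every five-point locally two-distance set in the plane `ℝ²` is a two-distance set, and it
is similar to the vertex set of a regular pentagon. -/
theorem stmt9 (X : Finset (EuclideanSpace ℝ (Fin 2)))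
    (hcard : X.card = 5) (hloc : ∀ x ∈ X, (distancesFrom X x).card ≤ 2) :
    (distSet X).card = 2 ∧
    ∃ (f : EuclideanSpace ℝ (Fin 2) → EuclideanSpace ℝ (Fin 2)) (r : ℝ), 0 < r ∧
      (∀ p q : EuclideanSpace ℝ (Fin 2), dist (f p) (f q) = r * dist p q) ∧
      X = regularPentagon.image f := by
  obtain ⟨p, hp, rfl⟩ : ∃ p : Fin 5 → EuclideanSpace ℝ (Fin 2), p.Injective ∧
      X = Finset.univ.image p := by
    let e := X.equivFinOfCardEq hcard
    refine ⟨fun i => e.symm i, Subtype.val_injective.comp e.symm.injective, ?_⟩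
    ext x
    simp only [Finset.mem_image, Finset.mem_univ, true_and]
    exact ⟨fun hx => ⟨e ⟨x, hx⟩, by simp⟩, by rintro ⟨i, rfl⟩; exact (e.symm i).2⟩
  have htwo : ∀ i, ∃ a b, ∀ j, i ≠ j → dist (p i) (p j) = a ∨ dist (p i) (p j) = b := by
    intro i
    obtain ⟨S, hS, hS2⟩ := Infinite.exists_superset_card_eq _ 2
      (hloc (p i) (Finset.mem_image_of_mem p (Finset.mem_univ i)))
    obtain ⟨a, b, -, rfl⟩ := Finset.card_eq_two.1 hS2
    refine ⟨a, b, fun j hij => ?_⟩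
    have : dist (p i) (p j) ∈ ({a, b} : Finset ℝ) := hS <| Finset.mem_image_of_mem _ <|
      Finset.mem_erase.2 ⟨hp.ne hij.symm, Finset.mem_image_of_mem p (Finset.mem_univ j)⟩
    simpa using this
  choose a b hab using htwo
  obtain ⟨s, t, hs, ht, hst⟩ : ∃ s t : ℝ, 0 < s ∧ 0 < t ∧
      ∀ i j, i ≠ j → dist (p i) (p j) = s ∨ dist (p i) (p j) = t := by
    obtain ⟨s, t, hst⟩ := two_valued_of_locally_two_valued (d := fun i j => dist (p i) (p j))
      (fun i j => dist_comm _ _) hab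
      (fun u v x y z huv hxy hxz hyz => eq_of_equidistant (hp.ne huv) (hp.ne hxy) (hp.ne hxz)
        (hp.ne hyz))
      (fun x₁ x₂ y₁ y₂ z hx hy hz => false_of_rhombus_of_equidistant (hp.ne hx) (hp.ne hy)
        (hp.ne hz))
    refine ⟨if 0 < s then s else 1, if 0 < t then t else 1, by split_ifs <;> simp [*],
      by split_ifs <;> simp [*], fun i j hij => ?_⟩
    have hpos : 0 < dist (p i) (p j) := dist_pos.2 (hp.ne hij)
    rcases hst i j hij with h | h
    · left; rw [if_pos (h ▸ hpos)]; exact h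
    · right; rw [if_pos (h ▸ hpos)]; exact h
  obtain ⟨hne, ⟨i, j, hij, hs'⟩, ⟨k, l, hkl, ht'⟩, σ, hσ, r, hr, hdist⟩ :=
    exists_pentagon_of_two_valued hp hs ht hst
  constructor
  · have : distSet (Finset.univ.image p) = {s, t} := by
      ext x
      simp only [distSet, Finset.mem_image, Finset.mem_offDiag, Finset.mem_univ, true_and,
        Finset.mem_insert, Finset.mem_singleton, Prod.exists]
      constructor
      · rintro ⟨_, _, ⟨⟨m, rfl⟩, ⟨n, rfl⟩, hmn⟩, rfl⟩
        exact hst m n fun h => hmn (congrArg p h)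
      · rintro (rfl | rfl)
        · exact ⟨_, _, ⟨⟨i, rfl⟩, ⟨j, rfl⟩, hp.ne hij⟩, hs'⟩
        · exact ⟨_, _, ⟨⟨k, rfl⟩, ⟨l, rfl⟩, hp.ne hkl⟩, ht'⟩
    rw [this, Finset.card_pair hne]
  · obtain ⟨f, hf, hfp⟩ := exists_similarity_of_dist_eq hr hdist
    refine ⟨f, r, hr, hf, ?_⟩
    have hσ' : σ.Surjective := Finite.surjective_of_injective hσ
    ext x
    simp only [Finset.mem_image, Finset.mem_univ, true_and, mem_regularPentagon]
    constructor
    · rintro ⟨i, rfl⟩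
      obtain ⟨j, rfl⟩ := hσ' i
      exact ⟨_, ⟨j, rfl⟩, hfp j⟩
    · rintro ⟨_, ⟨j, rfl⟩, rfl⟩
      exact ⟨σ j, (hfp j).symm⟩
end

section
/- Let X be a k-distance set on S^{d-1} with inner product set A_inn(X), and write F_X(t) = ∏_{α ∈ A_inn(X)} (t - α) = Σ_{i=0}^{k} f_i G_i^{(d)}(t) in terms of Gegenbauer polynomials. Then |X| ≤ Σ_{i : f_i > 0} h_i, where h_i = dim Harm_i(ℝ^d). -/
open scoped RealInnerProductSpace
open Polynomial

/-- The Gegenbauer polynomials `G_l^{(d)}`, normalized as in Delsarte–Goethals–Seidel: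
`G_0 = 1`, `G_1 = d·t`, and `t·G_l = λ_{l+1} G_{l+1} + (1 - λ_{l-1}) G_{l-1}` with
`λ_l = l / (d + 2l - 2)`. -/
noncomputable def gegenbauer (d : ℕ) : ℕ → Polynomial ℝ
  | 0 => 1
  | 1 => (d : ℝ) • Polynomial.X
  | (m + 2) =>
      (((d : ℝ) + 2 * (m : ℝ) + 2) / ((m : ℝ) + 2)) •
        (Polynomial.X * gegenbauer d (m + 1) -
          (1 - (m : ℝ) / ((d : ℝ) + 2 * (m : ℝ) - 2)) • gegenbauer d m)

/-- `hdim d i = dim Harm_i(ℝ^d)`, the dimension of the space of harmonic homogeneous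
polynomials of degree `i` in `d` variables. -/
def harmDim (d : ℕ) : ℕ → ℕ
  | 0 => 1
  | 1 => d
  | (i + 2) => (d + i + 1).choose (i + 2) - (d + i - 1).choose i

namespace HarmonicKernel

variable {ι : Type*}

lemma pderiv_comm (i j : ι) (p : MvPolynomial ι ℝ) :
    MvPolynomial.pderiv i (MvPolynomial.pderiv j p)
      = MvPolynomial.pderiv j (MvPolynomial.pderiv i p) := by
  classical
  have h : ⁅MvPolynomial.pderiv (R := ℝ) i, MvPolynomial.pderiv (R := ℝ) j⁆ = 0 := by
    apply MvPolynomial.derivation_ext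
    intro k
    simp [Derivation.commutator_apply, MvPolynomial.pderiv_X, Pi.single_apply, apply_ite]
  have := congrArg (fun D => D p) h
  simpa [Derivation.commutator_apply, sub_eq_zero] using this

variable [Fintype ι]

/-- The linear form `x ↦ ∑ i, y i * x i` as a polynomial. -/
noncomputable def linForm (y : ι → ℝ) : MvPolynomial ι ℝ :=
  ∑ i, MvPolynomial.C (y i) * MvPolynomial.X i

variable (ι) in
/-- The polynomial `∑ i, x i ^ 2`. -/
noncomputable def sqNorm : MvPolynomial ι ℝ :=
  ∑ i, MvPolynomial.X i * MvPolynomial.X i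

/-- The Laplacian on polynomials. -/
noncomputable def laplacian : MvPolynomial ι ℝ →ₗ[ℝ] MvPolynomial ι ℝ :=
  ∑ i, (MvPolynomial.pderiv i).toLinearMap ∘ₗ (MvPolynomial.pderiv i).toLinearMap

/-- The derivative of polynomials in the direction `y`. -/
noncomputable def dirDeriv (y : ι → ℝ) : Derivation ℝ (MvPolynomial ι ℝ) (MvPolynomial ι ℝ) :=
  ∑ i, y i • MvPolynomial.pderiv i

lemma laplacian_apply (p : MvPolynomial ι ℝ) :
    laplacian p = ∑ i, MvPolynomial.pderiv i (MvPolynomial.pderiv i p) := by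
  simp [laplacian]

lemma dirDeriv_apply (y : ι → ℝ) (p : MvPolynomial ι ℝ) :
    dirDeriv y p = ∑ i, MvPolynomial.C (y i) * MvPolynomial.pderiv i p := by
  have h := map_sum (Derivation.coeFnAddMonoidHom (R := ℝ) (A := MvPolynomial ι ℝ)
    (M := MvPolynomial ι ℝ)) (fun i => y i • MvPolynomial.pderiv i) Finset.univ
  refine (congrFun h p).trans ?_
  simp [MvPolynomial.smul_eq_C_mul]

lemma pderiv_linForm (y : ι → ℝ) (i : ι) :
    MvPolynomial.pderiv i (linForm y) = MvPolynomial.C (y i) := by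
  classical
  simp [linForm, MvPolynomial.pderiv_X, Pi.single_apply]

lemma pderiv_sqNorm (i : ι) :
    MvPolynomial.pderiv i (sqNorm ι) = 2 * MvPolynomial.X i := by
  classical
  simp [sqNorm, MvPolynomial.pderiv_X, Pi.single_apply,
    Finset.sum_add_distrib, two_mul]

lemma laplacian_dirDeriv (y : ι → ℝ) (p : MvPolynomial ι ℝ) :
    laplacian (dirDeriv y p) = dirDeriv y (laplacian p) := by
  simp only [laplacian_apply, dirDeriv_apply, map_sum, MvPolynomial.pderiv_C_mul]
  rw [Finset.sum_comm]
  refine Finset.sum_congr rfl fun j _ => Finset.sum_congr rfl fun i _ => ?_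
  rw [pderiv_comm i j (MvPolynomial.pderiv j p), pderiv_comm i j p]

lemma laplacian_C_mul (a : ℝ) (p : MvPolynomial ι ℝ) :
    laplacian (MvPolynomial.C a * p) = MvPolynomial.C a * laplacian p := by
  simp only [← MvPolynomial.smul_eq_C_mul, map_smul]

lemma dirDeriv_C_mul (y : ι → ℝ) (a : ℝ) (p : MvPolynomial ι ℝ) :
    dirDeriv y (MvPolynomial.C a * p) = MvPolynomial.C a * dirDeriv y p := by
  simp only [← MvPolynomial.smul_eq_C_mul, Derivation.map_smul]

lemma dirDeriv_mul (y : ι → ℝ) (p q : MvPolynomial ι ℝ) :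
    dirDeriv y (p * q) = dirDeriv y p * q + p * dirDeriv y q := by
  rw [Derivation.leibniz, smul_eq_mul, smul_eq_mul]; ring

lemma laplacian_linForm_mul (y : ι → ℝ) (p : MvPolynomial ι ℝ) :
    laplacian (linForm y * p) = linForm y * laplacian p + 2 * dirDeriv y p := by
  simp only [laplacian_apply, dirDeriv_apply, MvPolynomial.pderiv_mul, pderiv_linForm, map_add,
    MvPolynomial.pderiv_C, Finset.mul_sum, ← Finset.sum_add_distrib]
  refine Finset.sum_congr rfl fun i _ => ?_
  ring

lemma laplacian_sqNorm_mul {p : MvPolynomial ι ℝ} {m : ℕ} (hp : p.IsHomogeneous m) :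
    laplacian (sqNorm ι * p)
      = sqNorm ι * laplacian p + MvPolynomial.C (2 * Fintype.card ι + 4 * m : ℝ) * p := by
  have he := hp.sum_X_mul_pderiv
  have h : ∀ i : ι, MvPolynomial.pderiv i (MvPolynomial.pderiv i (sqNorm ι * p))
      = sqNorm ι * MvPolynomial.pderiv i (MvPolynomial.pderiv i p)
        + 4 * (MvPolynomial.X i * MvPolynomial.pderiv i p) + 2 * p := by
    intro i
    have h2 : MvPolynomial.pderiv i (2 : MvPolynomial ι ℝ) = 0 := by
      rw [← map_ofNat MvPolynomial.C 2, MvPolynomial.pderiv_C]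
    simp only [MvPolynomial.pderiv_mul, pderiv_sqNorm, map_add, MvPolynomial.pderiv_X_self, h2]
    ring
  rw [laplacian_apply, laplacian_apply, Finset.sum_congr rfl fun i _ => h i]
  rw [Finset.sum_add_distrib, Finset.sum_add_distrib, ← Finset.mul_sum, ← Finset.mul_sum, he,
    Finset.sum_const, Finset.card_univ, nsmul_eq_mul, nsmul_eq_mul, map_add, map_mul, map_mul,
    map_natCast, map_natCast, map_ofNat, map_ofNat]
  ring

lemma dirDeriv_linForm {y : ι → ℝ} (hy : ∑ i, y i * y i = 1) : dirDeriv y (linForm y) = 1 := by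
  simp only [dirDeriv_apply, pderiv_linForm, ← MvPolynomial.C_mul, ← map_sum, hy,
    MvPolynomial.C_1]

lemma dirDeriv_sqNorm (y : ι → ℝ) : dirDeriv y (sqNorm ι) = 2 * linForm y := by
  simp only [dirDeriv_apply, pderiv_sqNorm, linForm, Finset.mul_sum]
  exact Finset.sum_congr rfl fun i _ => by ring

lemma isHomogeneous_linForm (y : ι → ℝ) : (linForm y).IsHomogeneous 1 :=
  MvPolynomial.IsHomogeneous.sum _ _ _ fun _ _ =>
    MvPolynomial.isHomogeneous_C_mul_X _ _

lemma isHomogeneous_sqNorm : (sqNorm ι).IsHomogeneous 2 :=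
  MvPolynomial.IsHomogeneous.sum _ _ _ fun i _ =>
    (MvPolynomial.isHomogeneous_X ℝ i).mul (MvPolynomial.isHomogeneous_X ℝ i)

lemma sqNorm_ne_zero [Nonempty ι] : sqNorm ι ≠ 0 := by
  intro h
  have := congrArg (MvPolynomial.eval fun _ : ι => (1 : ℝ)) h
  simp [sqNorm] at this

lemma isHomogeneous_dirDeriv (y : ι → ℝ) {p : MvPolynomial ι ℝ} {m : ℕ}
    (hp : p.IsHomogeneous (m + 1)) : (dirDeriv y p).IsHomogeneous m := by
  rw [dirDeriv_apply]
  exact MvPolynomial.IsHomogeneous.sum _ _ _ fun i _ => by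
    simpa using (hp.pderiv (i := i)).C_mul (y i)

lemma eval_dirDeriv_self (y : ι → ℝ) {p : MvPolynomial ι ℝ} {m : ℕ} (hp : p.IsHomogeneous m) :
    MvPolynomial.eval y (dirDeriv y p) = m * MvPolynomial.eval y p := by
  have := congrArg (MvPolynomial.eval y) hp.sum_X_mul_pderiv
  simpa [dirDeriv_apply] using this

/-- The Fischer pairing: monomials are orthogonal and `⟨x^α, x^α⟩ = α!`. -/
noncomputable def fischer : MvPolynomial ι ℝ →ₗ[ℝ] MvPolynomial ι ℝ →ₗ[ℝ] ℝ :=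
  (MvPolynomial.basisMonomials ι ℝ).constr ℝ
    fun α => (∏ i, ((α i).factorial : ℝ)) • MvPolynomial.lcoeff ℝ α

lemma fischer_monomial (α : ι →₀ ℕ) (r : ℝ) (q : MvPolynomial ι ℝ) :
    fischer (MvPolynomial.monomial α r) q
      = r * ((∏ i, ((α i).factorial : ℝ)) * MvPolynomial.coeff α q) := by
  have h : MvPolynomial.monomial α r = r • MvPolynomial.basisMonomials ι ℝ α := by
    simp [MvPolynomial.coe_basisMonomials, MvPolynomial.smul_monomial]
  rw [h, map_smul, fischer, Module.Basis.constr_basis]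
  simp

lemma fischer_self (p : MvPolynomial ι ℝ) :
    fischer p p
      = ∑ α ∈ p.support, (∏ i, ((α i).factorial : ℝ)) * MvPolynomial.coeff α p ^ 2 := by
  conv_lhs => enter [1]; rw [p.as_sum]
  simp only [map_sum, LinearMap.sum_apply, fischer_monomial]
  exact Finset.sum_congr rfl fun α _ => by ring

lemma fischer_self_nonneg (p : MvPolynomial ι ℝ) : 0 ≤ fischer p p := by
  rw [fischer_self]; positivity

lemma fischer_self_eq_zero {p : MvPolynomial ι ℝ} (h : fischer p p = 0) : p = 0 := by
  rw [fischer_self, Finset.sum_eq_zero_iff_of_nonneg fun _ _ => by positivity] at h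
  ext α
  by_contra hα
  have h0 := h α (by simpa using hα)
  have : (∏ i, ((α i).factorial : ℝ)) ≠ 0 := by positivity
  simp_all

lemma fischer_X_mul (i : ι) (p q : MvPolynomial ι ℝ) :
    fischer (MvPolynomial.X i * p) q = fischer p (MvPolynomial.pderiv i q) := by
  classical
  induction p using MvPolynomial.induction_on' with
  | add p₁ p₂ h₁ h₂ => simp [mul_add, h₁, h₂]
  | monomial α r =>
    rw [MvPolynomial.X, MvPolynomial.monomial_mul, one_mul, fischer_monomial, fischer_monomial,
      MvPolynomial.coeff_pderiv, add_comm (Finsupp.single i 1) α]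
    have h : (∏ j, (((α + Finsupp.single i 1 : ι →₀ ℕ) j).factorial : ℝ))
        = (α i + 1) * ∏ j, ((α j).factorial : ℝ) := by
      rw [← Finset.mul_prod_erase _ _ (Finset.mem_univ i),
        ← Finset.mul_prod_erase _ (fun j => ((α j).factorial : ℝ)) (Finset.mem_univ i),
        ← mul_assoc]
      congr 1
      · simp [Nat.factorial_succ]
      · refine Finset.prod_congr rfl fun j hj => ?_
        simp [(Finset.ne_of_mem_erase hj).symm]
    rw [h]
    ring

lemma fischer_C_mul (a : ℝ) (p q : MvPolynomial ι ℝ) :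
    fischer (MvPolynomial.C a * p) q = a * fischer p q := by
  simp [← MvPolynomial.smul_eq_C_mul]

lemma fischer_sqNorm_mul (p q : MvPolynomial ι ℝ) :
    fischer (sqNorm ι * p) q = fischer p (laplacian q) := by
  simp [sqNorm, Finset.sum_mul, mul_assoc, fischer_X_mul, laplacian_apply]

lemma fischer_linForm_mul (y : ι → ℝ) (p q : MvPolynomial ι ℝ) :
    fischer (linForm y * p) q = fischer p (dirDeriv y q) := by
  simp [linForm, Finset.sum_mul, fischer_X_mul, dirDeriv_apply,
    ← MvPolynomial.smul_eq_C_mul]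

/-- The zonal harmonic of degree `l` with pole `y`, defined by the Gegenbauer recurrence. -/
noncomputable def zonal (y : ι → ℝ) : ℕ → MvPolynomial ι ℝ
  | 0 => 1
  | 1 => MvPolynomial.C (Fintype.card ι : ℝ) * linForm y
  | (m + 2) =>
      MvPolynomial.C (((Fintype.card ι : ℝ) + 2 * (m : ℝ) + 2) / ((m : ℝ) + 2)) *
        (linForm y * zonal y (m + 1) -
          MvPolynomial.C (1 - (m : ℝ) / ((Fintype.card ι : ℝ) + 2 * (m : ℝ) - 2)) *
            (sqNorm ι * zonal y m))

lemma isHomogeneous_zonal (y : ι → ℝ) : ∀ m, (zonal y m).IsHomogeneous m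
  | 0 => MvPolynomial.isHomogeneous_one _ _
  | 1 => (isHomogeneous_linForm y).C_mul _
  | (m + 2) => by
    rw [zonal]
    refine MvPolynomial.IsHomogeneous.C_mul (.sub ?_ (.C_mul ?_ _)) _
    · have := (isHomogeneous_linForm y).mul (isHomogeneous_zonal y (m + 1))
      rwa [show 1 + (m + 1) = m + 2 by ring] at this
    · have := isHomogeneous_sqNorm.mul (isHomogeneous_zonal y m)
      rwa [add_comm 2 m] at this

lemma dirDeriv_zonal_succ (hd : 2 ≤ Fintype.card ι) {y : ι → ℝ} (hy : ∑ i, y i * y i = 1) :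
    ∀ m : ℕ, dirDeriv y (zonal y (m + 1)) =
      MvPolynomial.C ((1 - (m : ℝ) / ((Fintype.card ι : ℝ) + 2 * (m : ℝ) - 2)) *
        ((Fintype.card ι : ℝ) + 2 * m)) * zonal y m
  | 0 => by simp [zonal, dirDeriv_linForm hy]
  | 1 => by
    have hd' : (2 : ℝ) ≤ Fintype.card ι := by exact_mod_cast hd
    have h0 : (Fintype.card ι : ℝ) ≠ 0 := by positivity
    simp only [zonal]
    rw [dirDeriv_C_mul, map_sub, dirDeriv_mul, dirDeriv_C_mul, dirDeriv_C_mul, dirDeriv_mul,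
      dirDeriv_linForm hy, dirDeriv_sqNorm, Derivation.map_one_eq_zero]
    have key : ((Fintype.card ι : ℝ) + 2 * ((0 : ℕ) : ℝ) + 2) / (((0 : ℕ) : ℝ) + 2) *
          (2 * (Fintype.card ι : ℝ) -
            2 * (1 - ((0 : ℕ) : ℝ) / ((Fintype.card ι : ℝ) + 2 * ((0 : ℕ) : ℝ) - 2)))
        = (1 - ((1 : ℕ) : ℝ) / ((Fintype.card ι : ℝ) + 2 * ((1 : ℕ) : ℝ) - 2)) *
          ((Fintype.card ι : ℝ) + 2 * (1 : ℕ)) * Fintype.card ι := by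
      simp
      field_simp
    have key' := congrArg (MvPolynomial.C (σ := ι)) key
    simp only [map_mul, map_sub, map_ofNat] at key' ⊢
    linear_combination linForm y * key'
  | (m + 2) => by
    have ih₁ := dirDeriv_zonal_succ hd hy (m + 1)
    have ih₀ := dirDeriv_zonal_succ hd hy m
    have hd' : (2 : ℝ) ≤ Fintype.card ι := by exact_mod_cast hd
    have hm : (0 : ℝ) ≤ m := by positivity
    rw [zonal, dirDeriv_C_mul, map_sub, dirDeriv_mul, dirDeriv_C_mul, dirDeriv_mul,
      dirDeriv_linForm hy, dirDeriv_sqNorm, ih₁, ih₀]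
    have hz : zonal y (m + 2) = _ := zonal.eq_3 y m
    set n : ℝ := (Fintype.card ι : ℝ) with hn
    set b₀ : ℝ := 1 - (m : ℝ) / (n + 2 * (m : ℝ) - 2) with hb₀
    set b₁ : ℝ := 1 - ((m + 1 : ℕ) : ℝ) / (n + 2 * ((m + 1 : ℕ) : ℝ) - 2) with hb₁
    set b₂ : ℝ := 1 - ((m + 2 : ℕ) : ℝ) / (n + 2 * ((m + 2 : ℕ) : ℝ) - 2) with hb₂
    set a₀ : ℝ := (n + 2 * (m : ℝ) + 2) / ((m : ℝ) + 2) with ha₀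
    set a₁ : ℝ := (n + 2 * ((m + 1 : ℕ) : ℝ) + 2) / (((m + 1 : ℕ) : ℝ) + 2) with ha₁
    have e₁ : b₁ * (n + 2 * m) = n + m - 1 := by
      have : n + 2 * (m : ℝ) ≠ 0 := by linarith
      rw [hb₁, show n + 2 * ((m + 1 : ℕ) : ℝ) - 2 = n + 2 * m by push_cast; ring]
      push_cast; field_simp; ring
    have e₂ : a₁ * (a₀ + (n + m - 1)) = b₂ * (n + 2 * ((m + 2 : ℕ) : ℝ)) * a₀ := by
      have : n + 2 * ((m : ℝ) + 2) - 2 ≠ 0 := by linarith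
      have : (m : ℝ) + 1 + 2 ≠ 0 := by linarith
      rw [hb₂, ha₁, ha₀]; push_cast; field_simp; ring
    have e₃ : b₁ * (n + 2 * ((m + 1 : ℕ) : ℝ)) - 2 * b₁ = n + m - 1 := by
      rw [← e₁]; push_cast; ring
    replace e₁ := congrArg (MvPolynomial.C (σ := ι)) e₁
    replace e₂ := congrArg (MvPolynomial.C (σ := ι)) e₂
    replace e₃ := congrArg (MvPolynomial.C (σ := ι)) e₃
    simp only [map_mul, map_sub, map_add, map_ofNat] at e₁ e₂ e₃ hz ⊢
    linear_combination MvPolynomial.C a₁ * linForm y * zonal y (m + 1) * e₃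
      - MvPolynomial.C a₁ * MvPolynomial.C b₀ * sqNorm ι * zonal y m * e₁
      + (MvPolynomial.C a₁
        - MvPolynomial.C b₂ * (MvPolynomial.C n + 2 * MvPolynomial.C ((m + 2 : ℕ) : ℝ))) * hz
      + (linForm y * zonal y (m + 1) - MvPolynomial.C b₀ * (sqNorm ι * zonal y m)) * e₂

lemma laplacian_zonal (hd : 2 ≤ Fintype.card ι) {y : ι → ℝ} (hy : ∑ i, y i * y i = 1) :
    ∀ m : ℕ, laplacian (zonal y m) = 0
  | 0 => by simp [zonal, laplacian_apply]
  | 1 => by simp [zonal, laplacian_apply, pderiv_linForm]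
  | (m + 2) => by
    rw [zonal, laplacian_C_mul, map_sub, laplacian_linForm_mul, laplacian_C_mul,
      laplacian_sqNorm_mul (isHomogeneous_zonal y m), laplacian_zonal hd hy m,
      laplacian_zonal hd hy (m + 1), dirDeriv_zonal_succ hd hy m]
    simp only [map_mul, map_add, map_ofNat]
    ring

/-- Zonal harmonics reproduce point evaluations of harmonic polynomials, up to a positive
factor. -/
lemma exists_fischer_zonal (hd : 2 ≤ Fintype.card ι) : ∀ m : ℕ, ∃ γ : ℝ, 0 < γ ∧
    ∀ (y : ι → ℝ) (q : MvPolynomial ι ℝ), q.IsHomogeneous m → laplacian q = 0 →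
      fischer (zonal y m) q = γ * MvPolynomial.eval y q
  | 0 => by
    refine ⟨1, one_pos, fun y q hq _ => ?_⟩
    rw [← MvPolynomial.totalDegree_zero_iff_isHomogeneous,
      MvPolynomial.totalDegree_eq_zero_iff_eq_C] at hq
    rw [hq, zonal, ← MvPolynomial.C_1, MvPolynomial.C_apply, fischer_monomial]
    simp
  | 1 => by
    obtain ⟨γ, hγ, h⟩ := exists_fischer_zonal hd 0
    have hd' : (0 : ℝ) < Fintype.card ι := by exact_mod_cast (by omega : 0 < Fintype.card ι)
    refine ⟨Fintype.card ι * γ, by positivity, fun y q hq hq' => ?_⟩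
    have h1 := h y (dirDeriv y q) (isHomogeneous_dirDeriv y hq)
      (by rw [laplacian_dirDeriv, hq', map_zero])
    rw [eval_dirDeriv_self y hq, ← fischer_linForm_mul] at h1
    rw [zonal, fischer_C_mul, ← mul_one (linForm y)]
    simp only [zonal] at h1
    rw [h1]; push_cast; ring
  | (m + 2) => by
    obtain ⟨γ, hγ, h⟩ := exists_fischer_zonal hd (m + 1)
    refine ⟨((Fintype.card ι : ℝ) + 2 * (m : ℝ) + 2) / ((m : ℝ) + 2) * ((m + 2) * γ),
      by positivity, fun y q hq hq' => ?_⟩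
    have h1 := h y (dirDeriv y q) (isHomogeneous_dirDeriv y hq)
      (by rw [laplacian_dirDeriv, hq', map_zero])
    rw [zonal, fischer_C_mul, map_sub, LinearMap.sub_apply, fischer_linForm_mul, h1, fischer_C_mul,
      fischer_sqNorm_mul, hq', map_zero, eval_dirDeriv_self y hq]
    push_cast
    ring

variable (ι) in
/-- The space of harmonic homogeneous polynomials of degree `m`. -/
noncomputable def harm (m : ℕ) : Submodule ℝ (MvPolynomial ι ℝ) :=
  MvPolynomial.homogeneousSubmodule ι ℝ m ⊓ LinearMap.ker laplacian

lemma mem_harm {m : ℕ} {p : MvPolynomial ι ℝ} :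
    p ∈ harm ι m ↔ p.IsHomogeneous m ∧ laplacian p = 0 := by
  simp [harm, MvPolynomial.mem_homogeneousSubmodule]

lemma setOf_degree_eq [DecidableEq ι] (m : ℕ) :
    {α : ι →₀ ℕ | α.degree = m} = ↑(Finset.univ.finsuppAntidiag m : Finset (ι →₀ ℕ)) := by
  ext α
  simp [Finset.mem_finsuppAntidiag, Finsupp.degree_eq_sum]

/-- Homogeneous polynomials of degree `m` as coefficient vectors. -/
noncomputable def homogeneousEquiv [DecidableEq ι] (m : ℕ) :
    MvPolynomial.homogeneousSubmodule ι ℝ m ≃ₗ[ℝ]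
      ((Finset.univ.finsuppAntidiag m : Finset (ι →₀ ℕ)) →₀ ℝ) :=
  (LinearEquiv.ofEq _ _ (by
    rw [MvPolynomial.homogeneousSubmodule_eq_finsupp_supported, setOf_degree_eq])).trans
    (AddMonoidAlgebra.supportedEquivFinsupp
      (↑(Finset.univ.finsuppAntidiag m : Finset (ι →₀ ℕ)) : Set (ι →₀ ℕ)))

instance (m : ℕ) : FiniteDimensional ℝ (MvPolynomial.homogeneousSubmodule ι ℝ m) := by
  classical
  exact Module.Finite.equiv (homogeneousEquiv m).symm

instance (m : ℕ) : FiniteDimensional ℝ (harm ι m) :=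
  Submodule.finiteDimensional_inf_left _ _

lemma finrank_homogeneousSubmodule (m : ℕ) :
    Module.finrank ℝ (MvPolynomial.homogeneousSubmodule ι ℝ m)
      = (Fintype.card ι + m - 1).choose m := by
  classical
  rw [(homogeneousEquiv m).finrank_eq, Module.finrank_finsupp_self, Fintype.card_coe,
    Finset.card_finsuppAntidiag_nat_eq_choose, Finset.card_univ]

lemma finrank_harm_le_homogeneous (m : ℕ) :
    Module.finrank ℝ (harm ι m) ≤ (Fintype.card ι + m - 1).choose m := by
  rw [← finrank_homogeneousSubmodule]
  exact Submodule.finrank_mono inf_le_left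

lemma finrank_harm_add_le [Nonempty ι] (m : ℕ) :
    Module.finrank ℝ (harm ι (m + 2)) + (Fintype.card ι + m - 1).choose m
      ≤ (Fintype.card ι + (m + 2) - 1).choose (m + 2) := by
  let M : MvPolynomial ι ℝ →ₗ[ℝ] MvPolynomial ι ℝ := LinearMap.mulLeft ℝ (sqNorm ι)
  have hM : Function.Injective M := mul_right_injective₀ sqNorm_ne_zero
  let P := (MvPolynomial.homogeneousSubmodule ι ℝ m).map M
  have hP : Module.finrank ℝ P = (Fintype.card ι + m - 1).choose m := by
    rw [← finrank_homogeneousSubmodule]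
    exact (LinearEquiv.finrank_eq (Submodule.equivMapOfInjective M hM _)).symm
  have hdisj : harm ι (m + 2) ⊓ P = ⊥ := by
    rw [Submodule.eq_bot_iff]
    rintro _ ⟨hh, p, -, rfl⟩
    refine fischer_self_eq_zero ?_
    rw [LinearMap.mulLeft_apply] at hh ⊢
    rw [fischer_sqNorm_mul, (mem_harm.1 hh).2, map_zero]
  have hle : harm ι (m + 2) ⊔ P ≤ MvPolynomial.homogeneousSubmodule ι ℝ (m + 2) := by
    refine sup_le inf_le_left ?_
    rintro _ ⟨p, hp, rfl⟩
    have := isHomogeneous_sqNorm.mul ((MvPolynomial.mem_homogeneousSubmodule _ _).1 hp)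
    rwa [add_comm 2 m] at this
  have h1 := Submodule.finrank_sup_add_finrank_inf_eq (harm ι (m + 2)) P
  have h2 := Submodule.finrank_mono hle
  rw [finrank_homogeneousSubmodule] at h2
  rw [hdisj, finrank_bot, hP] at h1
  omega

lemma finrank_harm_le (d : ℕ) (hd : 2 ≤ d) :
    ∀ m, Module.finrank ℝ (harm (Fin d) m) ≤ harmDim d m
  | 0 => by simpa [harmDim] using finrank_harm_le_homogeneous (ι := Fin d) 0
  | 1 => by simpa [harmDim] using finrank_harm_le_homogeneous (ι := Fin d) 1
  | (m + 2) => by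
    have : Nonempty (Fin d) := ⟨⟨0, by omega⟩⟩
    have h := finrank_harm_add_le (ι := Fin d) m
    rw [Fintype.card_fin] at h
    rw [harmDim]
    exact Nat.le_sub_of_add_le h

lemma sum_mul_self_eq_one {d : ℕ} {x : EuclideanSpace ℝ (Fin d)} (hx : ‖x‖ = 1) :
    ∑ i, x i * x i = 1 := by
  have := EuclideanSpace.real_norm_sq_eq x
  simpa [hx, sq] using this.symm

lemma eval_zonal {d : ℕ} (x y : EuclideanSpace ℝ (Fin d)) (hx : ‖x‖ = 1) :
    ∀ m, MvPolynomial.eval x (zonal y m) = (gegenbauer d m).eval ⟪x, y⟫ := by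
  have hl : MvPolynomial.eval x (linForm y) = ⟪x, y⟫ := by
    simp [linForm, PiLp.inner_apply]
  have hs : MvPolynomial.eval x (sqNorm (Fin d)) = 1 := by
    simpa [sqNorm] using sum_mul_self_eq_one hx
  intro m
  induction m using Nat.twoStepInduction with
  | zero => simp [zonal, gegenbauer]
  | one => simp [zonal, gegenbauer, hl]
  | more m h₀ h₁ => simp [zonal, gegenbauer, hl, hs, h₀, h₁]

end HarmonicKernel

open HarmonicKernel

/-- New upper bound for `k`-distance sets on `S^{d-1}`: if
`F_X(t) = ∏_{α ∈ A_inn(X)} (t - α) = Σ_{i=0}^k f_i G_i^{(d)}(t)`, then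
`|X| ≤ Σ_{i : f_i > 0} h_i` where `h_i = dim Harm_i(ℝ^d)`. -/
theorem stmt13 (d k : ℕ) (hd : 2 ≤ d) (X : Finset (EuclideanSpace ℝ (Fin d)))
    (hsph : ∀ x ∈ X, ‖x‖ = 1)
    (A : Finset ℝ) (hA : ∀ r : ℝ, r ∈ A ↔ ∃ x ∈ X, ∃ y ∈ X, x ≠ y ∧ ⟪x, y⟫ = r)
    (hk : A.card = k)
    (f : ℕ → ℝ)
    (hf : ∏ α ∈ A, (Polynomial.X - Polynomial.C α)
        = ∑ i ∈ Finset.range (k + 1), Polynomial.C (f i) * gegenbauer d i) :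
    X.card ≤ ∑ i ∈ (Finset.range (k + 1)).filter (fun i => 0 < f i), harmDim d i := by
  have hd' : 2 ≤ Fintype.card (Fin d) := by simpa using hd
  have hunit : ∀ x : X, ∑ i, x.1 i * x.1 i = 1 := fun x =>
    sum_mul_self_eq_one (hsph x.1 x.2)
  have hF : ∀ t : ℝ, ∏ α ∈ A, (t - α)
      = ∑ i ∈ Finset.range (k + 1), f i * (gegenbauer d i).eval t := fun t => by
    simpa [Polynomial.eval_prod, Polynomial.eval_finsetSum] using congrArg (Polynomial.eval t) hf
  have hF1 : 0 < ∏ α ∈ A, ((1 : ℝ) - α) := by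
    refine Finset.prod_pos fun α hα => ?_
    obtain ⟨x, hx, y, hy, hxy, rfl⟩ := (hA α).1 hα
    exact sub_pos.2 ((inner_lt_one_iff_real_of_norm_eq_one (hsph x hx) (hsph y hy)).2 hxy)
  choose γ hγ hrep using fun m => exists_fischer_zonal (ι := Fin d) hd' m
  have hgram : ∀ (m : ℕ) (x y : X),
      (gegenbauer d m).eval ⟪x.1, y.1⟫ = (γ m)⁻¹ * fischer (zonal x.1 m) (zonal y.1 m) := by
    intro m x y
    rw [hrep m _ _ (isHomogeneous_zonal _ m) (laplacian_zonal hd' (hunit y) m),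
      eval_zonal _ _ (hsph x.1 x.2), inv_mul_cancel_left₀ (hγ m).ne']
  let S := (Finset.range (k + 1)).filter (fun i => 0 < f i)
  let Z : (m : ℕ) → X → harm (Fin d) m := fun m x =>
    ⟨zonal x.1 m, mem_harm.2 ⟨isHomogeneous_zonal _ m, laplacian_zonal hd' (hunit x) m⟩⟩
  let L : (X → ℝ) →ₗ[ℝ] ((i : S) → harm (Fin d) i) :=
    LinearMap.pi fun i => Fintype.linearCombination ℝ (Z i)
  by_contra! hlt
  have hrank : Module.finrank ℝ ((i : S) → harm (Fin d) i) < Module.finrank ℝ (X → ℝ) := by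
    rw [Module.finrank_pi_fintype, Module.finrank_fintype_fun_eq_card, Fintype.card_coe]
    refine lt_of_le_of_lt ?_ hlt
    rw [← Finset.sum_coe_sort S]
    exact Finset.sum_le_sum fun i _ => finrank_harm_le d hd i
  obtain ⟨v, hv, hv0⟩ := (Submodule.ne_bot_iff _).1 (L.ker_ne_bot_of_finrank_lt hrank)
  have hker : ∀ i ∈ S, ∑ x, v x • zonal x.1.ofLp i = 0 := by
    intro i hi
    have h := congrArg (fun w => ((w ⟨i, hi⟩ : harm (Fin d) i) : MvPolynomial (Fin d) ℝ))
      (LinearMap.mem_ker.1 hv)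
    simpa [L, Z, Fintype.linearCombination_apply] using h
  have hleft : ∑ x, ∑ y, v x * v y * ∏ α ∈ A, (⟪x.1, y.1⟫ - α)
      = (∏ α ∈ A, ((1 : ℝ) - α)) * ∑ x, v x ^ 2 := by
    rw [Finset.mul_sum]
    refine Finset.sum_congr rfl fun x _ => ?_
    rw [Finset.sum_eq_single x]
    · rw [real_inner_self_eq_norm_sq, hsph x.1 x.2]; norm_num; ring
    · intro y _ hyx
      rw [Finset.prod_eq_zero ((hA ⟪x.1, y.1⟫).2
        ⟨x, x.2, y, y.2, fun h => hyx (Subtype.ext h.symm), rfl⟩) (sub_self _), mul_zero]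
    · simp
  have hright : ∑ x, ∑ y, v x * v y * ∏ α ∈ A, (⟪x.1, y.1⟫ - α)
      = ∑ i ∈ Finset.range (k + 1), f i * ((γ i)⁻¹ *
          fischer (∑ x, v x • zonal x.1.ofLp i) (∑ y, v y • zonal y.1.ofLp i)) := by
    simp only [hF, hgram, map_sum, map_smul, LinearMap.sum_apply, LinearMap.smul_apply,
      Finset.mul_sum, smul_eq_mul]
    rw [Finset.sum_congr rfl fun x _ => Finset.sum_comm, Finset.sum_comm]
    refine Finset.sum_congr rfl fun i _ => ?_
    rw [Finset.sum_comm]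
    exact Finset.sum_congr rfl fun y _ => Finset.sum_congr rfl fun x _ => by ring
  have hpos : 0 < ∑ x, v x ^ 2 := by
    obtain ⟨x, hx⟩ := Function.ne_iff.1 hv0
    exact Finset.sum_pos' (fun _ _ => sq_nonneg _) ⟨x, Finset.mem_univ x, sq_pos_of_ne_zero hx⟩
  have hneg : ∑ i ∈ Finset.range (k + 1), f i * ((γ i)⁻¹ *
      fischer (∑ x, v x • zonal x.1.ofLp i) (∑ y, v y • zonal y.1.ofLp i)) ≤ 0 := by
    refine Finset.sum_nonpos fun i hi => ?_
    by_cases hfi : 0 < f i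
    · rw [hker i (Finset.mem_filter.2 ⟨hi, hfi⟩)]; simp
    · exact mul_nonpos_of_nonpos_of_nonneg (not_lt.1 hfi)
        (mul_nonneg (inv_nonneg.2 (hγ i).le) (fischer_self_nonneg _))
  linarith [mul_pos hF1 hpos]
end
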